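/- Let B ≥ 1 be a real number and let (f_m) be a sequence of polynomials with integer coefficients such that each f_m satisfies f_m(0) ≠ 0, the sum of the absolute values of the coefficients of each f_m is at most B, and deg(f_m) → ∞ as m → ∞. Then the number of distinct complex roots of f_m tends to infinity as m → ∞. -/

import Mathlib

open Polynomial Filter

namespace Polynomial

theorem card_support_divX_le {R : Type*} [Semiring R] (p : R[X]) :
    p.divX.support.card ≤ p.support.card := by
  refine Finset.card_le_card_of_injOn Nat.succ (fun n hn => ?_) Nat.succ_injective.injOn
  simpa [coeff_divX] using hn

theorem card_support_derivative_lt {R : Type*} [Semiring R] {p : R[X]} (h0 : p.coeff 0 ≠ 0) :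
    (derivative p).support.card < p.support.card := by
  have hmem : 0 ∈ p.support := mem_support_iff.2 h0
  refine lt_of_le_of_lt ?_ (Finset.card_erase_lt_of_mem hmem)
  refine Finset.card_le_card_of_injOn Nat.succ (fun n hn => ?_) Nat.succ_injective.injOn
  simp only [Finset.mem_coe, mem_support_iff, coeff_derivative] at hn
  simpa using left_ne_zero_of_mul hn

/-- The multiplicity of a nonzero root is smaller than the number of nonzero coefficients. -/
theorem rootMultiplicity_lt_card_support {R : Type*} [CommRing R] [IsDomain R] [CharZero R]
    {p : R[X]} (hp : p ≠ 0) {t : R} (ht : t ≠ 0) :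
    p.rootMultiplicity t < p.support.card := by
  induction hn : p.natDegree using Nat.strong_induction_on generalizing p with
  | _ n ih =>
    rcases Nat.eq_zero_or_pos p.natDegree with hd | hd
    · obtain ⟨c, rfl⟩ := natDegree_eq_zero.1 hd
      rw [rootMultiplicity_C]
      exact Finset.card_pos.2 (nonempty_support_iff.2 hp)
    by_cases h0 : p.coeff 0 = 0
    · have hpX : p.divX * X = p := by simpa [h0] using divX_mul_X_add p
      have hq : p.divX ≠ 0 := fun h => hp (by rw [← hpX, h, zero_mul])
      have hmul : p.rootMultiplicity t = p.divX.rootMultiplicity t := by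
        conv_lhs => rw [← hpX]
        rw [rootMultiplicity_mul (by rwa [hpX]),
          rootMultiplicity_eq_zero (p := X) (by simpa [IsRoot] using ht), add_zero]
      rw [hmul]
      refine (ih _ ?_ hq rfl).trans_le (card_support_divX_le p)
      rw [natDegree_divX_eq_natDegree_tsub_one]
      omega
    · have hq : derivative p ≠ 0 := fun h => hd.ne' (derivative_eq_zero.1 h)
      have hlt := ih _ (hn ▸ natDegree_derivative_lt hd.ne') hq rfl
      have hle := rootMultiplicity_sub_one_le_derivative_rootMultiplicity_of_ne_zero p t hq
      have := card_support_derivative_lt h0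
      omega

theorem card_support_le_sum_abs_coeff (p : ℤ[X]) :
    (p.support.card : ℝ) ≤ ∑ i ∈ Finset.range (p.natDegree + 1), (|p.coeff i| : ℝ) := by
  calc (p.support.card : ℝ) = ∑ i ∈ p.support, (1 : ℝ) := by simp
    _ ≤ ∑ i ∈ p.support, (|p.coeff i| : ℝ) := Finset.sum_le_sum fun i hi => by
        exact_mod_cast Int.one_le_abs (mem_support_iff.1 hi)
    _ ≤ _ := Finset.sum_le_sum_of_subset_of_nonneg supp_subset_range_natDegree_succ
        fun i _ _ => abs_nonneg _

/-- A polynomial over an algebraically closed field of characteristic zero that does not vanish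
at `0` has degree at most the number of its distinct roots times one less than the number of its
nonzero coefficients. -/
theorem natDegree_le_card_roots_toFinset_mul {K : Type*} [Field K] [IsAlgClosed K] [CharZero K]
    [DecidableEq K] {p : K[X]} (h0 : p.eval 0 ≠ 0) :
    p.natDegree ≤ p.roots.toFinset.card * (p.support.card - 1) := by
  have hp : p ≠ 0 := by rintro rfl; simp at h0
  rw [(IsAlgClosed.splits p).natDegree_eq_card_roots, ← Multiset.toFinset_sum_count_eq,
    ← smul_eq_mul]
  refine Finset.sum_le_card_nsmul _ _ _ fun t ht => ?_
  have ht0 : t ≠ 0 := by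
    rintro rfl
    exact h0 (isRoot_of_mem_roots (Multiset.mem_toFinset.1 ht))
  rw [count_roots]
  exact Nat.le_sub_one_of_lt (rootMultiplicity_lt_card_support hp ht0)

end Polynomial

/-- If `(f_m)` are integer polynomials with `f_m(0) ≠ 0`, coefficient `L¹`-norms uniformly
bounded by `B ≥ 1`, and `deg f_m → ∞`, then the number of distinct complex roots of `f_m`
tends to infinity. -/
theorem distinct_roots_tendsto_atTop (B : ℝ) (hB : 1 ≤ B) (f : ℕ → Polynomial ℤ)
    (h0 : ∀ m, (f m).eval 0 ≠ 0)
    (hL1 : ∀ m, (∑ i ∈ Finset.range ((f m).natDegree + 1), (|(f m).coeff i| : ℝ)) ≤ B)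
    (hdeg : Tendsto (fun m => (f m).natDegree) atTop atTop) :
    Tendsto (fun m => ((f m).map (Int.castRingHom ℂ)).roots.toFinset.card) atTop atTop := by
  have hinj : Function.Injective (Int.castRingHom ℂ) := Int.cast_injective
  have hbound : ∀ m, (f m).natDegree ≤
      ((f m).map (Int.castRingHom ℂ)).roots.toFinset.card * ⌊B⌋₊ := fun m => by
    have hcard : (f m).support.card ≤ ⌊B⌋₊ :=
      Nat.le_floor ((card_support_le_sum_abs_coeff (f m)).trans (hL1 m))
    have heval : ((f m).map (Int.castRingHom ℂ)).eval 0 ≠ 0 := by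
      rw [eval_zero_map]
      exact (map_ne_zero_iff _ hinj).2 (h0 m)
    have hle := natDegree_le_card_roots_toFinset_mul heval
    rw [natDegree_map_eq_of_injective hinj, support_map_of_injective _ hinj] at hle
    exact hle.trans (Nat.mul_le_mul_left _ ((Nat.sub_le _ _).trans hcard))
  refine tendsto_atTop.2 fun N => ?_
  filter_upwards [hdeg.eventually_gt_atTop (N * ⌊B⌋₊)] with m hm
  exact (lt_of_mul_lt_mul_right (hm.trans_le (hbound m)) (Nat.zero_le _)).le
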